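/- For every set E ⊆ ℝ^n (with the Euclidean metric), the uncentered packing dimension of E equals its packing dimension: dim_{P(unc)}(E) = dim_P(E). -/

import Mathlib

open Metric Set Filter MeasureTheory
open scoped ENNReal Classical

noncomputable section

variable {M : Type*} [MetricSpace M]

/-- The centered `α`-dimensional packing `ε`-premeasure of `E`: the supremum of
`∑ |E_i|^α` over countable families of pairwise disjoint open balls of diameter
at most `ε` with centers in `E`. -/
def cPackPre (α ε : ℝ) (E : Set M) : ℝ≥0∞ :=
  ⨆ (P : Set (M × ℝ)) (_ : P.Countable)
    (_ : ∀ p ∈ P, p.1 ∈ E ∧ 0 < p.2 ∧ EMetric.diam (ball p.1 p.2) ≤ ENNReal.ofReal ε)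
    (_ : P.Pairwise fun p q => Disjoint (ball p.1 p.2) (ball q.1 q.2)),
    ∑' p : P, EMetric.diam (ball p.1.1 p.1.2) ^ α

/-- The centered packing quasi-measure `P^α_0(E) = lim_{ε→0} P^α_ε(E)`. -/
def cPackPre0 (α : ℝ) (E : Set M) : ℝ≥0∞ := ⨅ (ε : ℝ) (_ : 0 < ε), cPackPre α ε E

/-- The centered `α`-dimensional packing measure. -/
def cPackMeasure (α : ℝ) (E : Set M) : ℝ≥0∞ :=
  ⨅ (c : ℕ → Set M) (_ : E ⊆ ⋃ n, c n), ∑' n, cPackPre0 α (c n)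

/-- The packing dimension `dim_P(E) = inf {α ≥ 0 : P^α(E) = 0}`. -/
def cPackDim (E : Set M) : ℝ≥0∞ :=
  ⨅ (α : ℝ) (_ : 0 ≤ α) (_ : cPackMeasure α E = 0), ENNReal.ofReal α

/-- The uncentered `α`-dimensional packing `ε`-premeasure of `E`: as `cPackPre`
but each ball is only required to meet `E`. -/
def uPackPre (α ε : ℝ) (E : Set M) : ℝ≥0∞ :=
  ⨆ (P : Set (M × ℝ)) (_ : P.Countable)
    (_ : ∀ p ∈ P, (ball p.1 p.2 ∩ E).Nonempty ∧ 0 < p.2 ∧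
        EMetric.diam (ball p.1 p.2) ≤ ENNReal.ofReal ε)
    (_ : P.Pairwise fun p q => Disjoint (ball p.1 p.2) (ball q.1 q.2)),
    ∑' p : P, EMetric.diam (ball p.1.1 p.1.2) ^ α

/-- The uncentered packing quasi-measure. -/
def uPackPre0 (α : ℝ) (E : Set M) : ℝ≥0∞ := ⨅ (ε : ℝ) (_ : 0 < ε), uPackPre α ε E

/-- The uncentered `α`-dimensional packing measure. -/
def uPackMeasure (α : ℝ) (E : Set M) : ℝ≥0∞ :=
  ⨅ (c : ℕ → Set M) (_ : E ⊆ ⋃ n, c n), ∑' n, uPackPre0 α (c n)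

/-- The uncentered packing dimension `dim_{P(unc)}(E)`. -/
def uPackDim (E : Set M) : ℝ≥0∞ :=
  ⨅ (α : ℝ) (_ : 0 ≤ α) (_ : uPackMeasure α E = 0), ENNReal.ofReal α

/-- The `α`-dimensional packing `ε`-premeasure of `E` with respect to a family `Φ`:
supremum of `∑ |E_i|^α` over countable pairwise disjoint families of sets from `Φ`
of diameter at most `ε`, each meeting `E`. -/
def famPackPre (α ε : ℝ) (E : Set M) (Φ : Set (Set M)) : ℝ≥0∞ :=
  ⨆ (P : Set (Set M)) (_ : P.Countable) (_ : P ⊆ Φ)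
    (_ : ∀ B ∈ P, (B ∩ E).Nonempty ∧ EMetric.diam B ≤ ENNReal.ofReal ε)
    (_ : P.Pairwise Disjoint),
    ∑' B : P, EMetric.diam (B : Set M) ^ α

/-- Packing quasi-measure with respect to `Φ`. -/
def famPackPre0 (α : ℝ) (E : Set M) (Φ : Set (Set M)) : ℝ≥0∞ :=
  ⨅ (ε : ℝ) (_ : 0 < ε), famPackPre α ε E Φ

/-- Packing measure with respect to `Φ`. -/
def famPackMeasure (α : ℝ) (E : Set M) (Φ : Set (Set M)) : ℝ≥0∞ :=
  ⨅ (c : ℕ → Set M) (_ : E ⊆ ⋃ n, c n), ∑' n, famPackPre0 α (c n) Φ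

/-- Packing dimension of `E` with respect to the family `Φ`. -/
def famPackDim (E : Set M) (Φ : Set (Set M)) : ℝ≥0∞ :=
  ⨅ (α : ℝ) (_ : 0 ≤ α) (_ : famPackMeasure α E Φ = 0), ENNReal.ofReal α

/-- The packing dimension of a measure: `inf {dim_P E : μ E = 1}`. -/
def measPackDim (μ : Measure ℝ) : ℝ≥0∞ := ⨅ (E : Set ℝ) (_ : μ E = 1), cPackDim E

lemma cPackPre_le_uPackPre (α ε : ℝ) (E : Set M) : cPackPre α ε E ≤ uPackPre α ε E := by
  refine iSup_le fun P => iSup_le fun hc => iSup_le fun hP => iSup_le fun hd => ?_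
  refine le_iSup_of_le P <| le_iSup_of_le hc <| le_iSup_of_le (fun p hp => ?_) <|
    le_iSup_of_le hd le_rfl
  obtain ⟨h1, h2, h3⟩ := hP p hp
  exact ⟨⟨p.1, mem_ball_self h2, h1⟩, h2, h3⟩

lemma cPackMeasure_le_uPackMeasure (α : ℝ) (E : Set M) :
    cPackMeasure α E ≤ uPackMeasure α E :=
  iInf₂_mono fun c _ => ENNReal.tsum_le_tsum fun n =>
    iInf₂_mono fun ε _ => cPackPre_le_uPackPre α ε (c n)

lemma cPackDim_le_uPackDim (E : Set M) : cPackDim E ≤ uPackDim E := by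
  refine le_iInf fun α => le_iInf fun hα => le_iInf fun h => ?_
  exact iInf_le_of_le α <| iInf_le_of_le hα <|
    iInf_le_of_le (le_antisymm (h ▸ cPackMeasure_le_uPackMeasure α E) zero_le) le_rfl

section NormedSpace

variable {V : Type*} [NormedAddCommGroup V] [NormedSpace ℝ V]

lemma ediam_ball_eq [Nontrivial V] (x : V) {r : ℝ} (hr : 0 < r) :
    EMetric.diam (ball x r) = ENNReal.ofReal (2 * r) := by
  rw [← Metric.diam_ball_eq x hr.le, Metric.diam,
    ENNReal.ofReal_toReal isBounded_ball.ediam_ne_top, EMetric.diam]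

/-- Disjoint balls of radius at least `s`, within `2 * s` of points `y p` of a set, number at most
`5 ^ d` times a suitable disjoint subfamily of balls of radius `s` centered at the points `y p`. -/
lemma exists_disjoint_subset_tsum_le [FiniteDimensional ℝ V] {s : ℝ} (hs : 0 < s)
    {P : Set (V × ℝ)} (hc : P.Countable) (y : V × ℝ → V)
    (hy : ∀ p ∈ P, dist p.1 (y p) < 2 * s) (hsP : ∀ p ∈ P, s ≤ p.2)
    (hd : P.Pairwise fun p q => Disjoint (ball p.1 p.2) (ball q.1 q.2)) :
    ∃ U ⊆ P, U.PairwiseDisjoint (fun p => ball (y p) s) ∧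
      ∑' _ : P, (1 : ℝ≥0∞) ≤ 5 ^ Module.finrank ℝ V * ∑' _ : U, (1 : ℝ≥0∞) := by
  obtain ⟨U, hUP, hUd, hU⟩ := Vitali.exists_disjoint_subfamily_covering_enlargement
    (fun p => ball (y p) s) P (fun _ => 0) 2 one_lt_two (fun _ _ => le_rfl) 0 (fun _ _ => le_rfl)
    (fun p _ => nonempty_ball.2 hs)
  refine ⟨U, hUP, hUd, ?_⟩
  borelize V
  let μ : Measure V := Measure.addHaar
  set v := μ (ball 0 s) with hv
  have hv0 : v ≠ 0 := (measure_ball_pos μ 0 hs).ne'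
  have hvt : v ≠ ∞ := measure_ball_lt_top.ne
  have h5 : ∀ x : V, μ (ball x (5 * s)) = 5 ^ Module.finrank ℝ V * v := fun x => by
    rw [Measure.addHaar_ball_mul_of_pos μ x (by norm_num), ENNReal.ofReal_pow (by norm_num)]
    norm_num [hv]
  have hsub : (⋃ p ∈ P, ball p.1 s) ⊆ ⋃ q ∈ U, ball (y q) (5 * s) := by
    refine iUnion₂_subset fun p hp z hz => ?_
    obtain ⟨q, hq, ⟨w, hw1, hw2⟩, -⟩ := hU p hp
    refine mem_iUnion₂.2 ⟨q, hq, ?_⟩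
    have h1 := hy p hp
    simp only [mem_ball] at hz hw1 hw2 ⊢
    have h2 := dist_triangle z p.1 (y q)
    have h3 := dist_triangle p.1 (y p) (y q)
    have h4 := dist_triangle_left (y p) (y q) w
    linarith
  have key : (∑' _ : P, (1 : ℝ≥0∞)) * v ≤ (5 ^ Module.finrank ℝ V * ∑' _ : U, (1 : ℝ≥0∞)) * v :=
    calc (∑' _ : P, (1 : ℝ≥0∞)) * v = ∑' p : P, μ (ball p.1.1 s) := by
          rw [← ENNReal.tsum_mul_right]
          simp only [one_mul, Measure.addHaar_ball_center μ _ s, hv]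
      _ = μ (⋃ p ∈ P, ball p.1 s) := by
          refine (measure_biUnion hc (fun p hp q hq hpq => ?_) fun _ _ => measurableSet_ball).symm
          exact (hd hp hq hpq).mono (ball_subset_ball (hsP p hp)) (ball_subset_ball (hsP q hq))
      _ ≤ μ (⋃ q ∈ U, ball (y q) (5 * s)) := measure_mono hsub
      _ ≤ ∑' q : U, μ (ball (y q) (5 * s)) := measure_biUnion_le μ (hc.mono hUP) _
      _ = (5 ^ Module.finrank ℝ V * ∑' _ : U, (1 : ℝ≥0∞)) * v := by
          simp only [h5]
          rw [← ENNReal.tsum_mul_left, ← ENNReal.tsum_mul_right]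
          simp
  exact (ENNReal.mul_le_mul_iff_left hv0 hvt).1 key

lemma tsum_ofReal_rpow_le_cPackPre [Nontrivial V] {α ε s : ℝ} (hs : 0 < s) (hε : 2 * s ≤ ε)
    {F : Set V} {U : Set (V × ℝ)} (hc : U.Countable) {y : V × ℝ → V} (hy : ∀ p ∈ U, y p ∈ F)
    (hd : U.PairwiseDisjoint fun p => ball (y p) s) :
    ∑' _ : U, ENNReal.ofReal (2 * s) ^ α ≤ cPackPre α ε F := by
  have hinj : InjOn (fun p => (y p, s)) U := fun p hp q hq hpq => by
    by_contra hne
    have h := hd hp hq hne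
    simp only [Prod.mk.injEq, and_true] at hpq
    simp only [Function.onFun, hpq, disjoint_self, bot_eq_empty] at h
    exact (nonempty_ball.2 hs).ne_empty h
  refine le_iSup_of_le ((fun p => (y p, s)) '' U) <| le_iSup_of_le (hc.image _) <|
    le_iSup_of_le ?_ <| le_iSup_of_le ?_ ?_
  · rintro _ ⟨p, hp, rfl⟩
    exact ⟨hy p hp, hs, by
      rw [ediam_ball_eq _ hs]; exact ENNReal.ofReal_le_ofReal hε⟩
  · rintro _ ⟨p, hp, rfl⟩ _ ⟨q, hq, rfl⟩ hne
    exact hd hp hq fun h => hne (by rw [h])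
  · rw [tsum_image (fun p : V × ℝ => EMetric.diam (ball p.1 p.2) ^ α) hinj]
    simp only [ediam_ball_eq _ hs, le_refl]

/-- A disjoint family of balls with radii in `(s, 2 * s]` that meet `F` is controlled by the
centered packing premeasure of `F` of a smaller exponent. -/
lemma tsum_ediam_rpow_le_cPackPre [FiniteDimensional ℝ V] [Nontrivial V] {α β ε s : ℝ}
    (hβ : 0 ≤ β) (hs : 0 < s) (hε : 2 * s ≤ ε) {F : Set V}
    {P : Set (V × ℝ)} (hc : P.Countable) (hF : ∀ p ∈ P, (ball p.1 p.2 ∩ F).Nonempty)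
    (hsP : ∀ p ∈ P, s < p.2) (hPs : ∀ p ∈ P, p.2 ≤ 2 * s)
    (hd : P.Pairwise fun p q => Disjoint (ball p.1 p.2) (ball q.1 q.2)) :
    ∑' p : P, EMetric.diam (ball p.1.1 p.1.2) ^ β ≤
      2 ^ β * 5 ^ Module.finrank ℝ V * cPackPre α ε F * ENNReal.ofReal (2 * s) ^ (β - α) := by
  choose! y hy using hF
  obtain ⟨U, hUP, hUd, hU⟩ := exists_disjoint_subset_tsum_le hs hc y
    (fun p hp => (mem_ball'.1 (hy p hp).1).trans_le (hPs p hp)) (fun p hp => (hsP p hp).le) hd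
  have hU' := tsum_ofReal_rpow_le_cPackPre (α := α) hs hε (hc.mono hUP)
    (fun p hp => (hy p (hUP hp)).2) hUd
  set D := ENNReal.ofReal (2 * s) with hD
  have hD0 : D ≠ 0 := by simpa [hD] using hs
  have hDt : D ≠ ∞ := ENNReal.ofReal_ne_top
  calc ∑' p : P, EMetric.diam (ball p.1.1 p.1.2) ^ β
      ≤ ∑' _ : P, (2 * D) ^ β := by
        refine ENNReal.tsum_le_tsum fun p => ENNReal.rpow_le_rpow ?_ hβ
        rw [ediam_ball_eq _ (hs.trans (hsP p p.2)), ENNReal.ofReal_mul zero_le_two,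
          ENNReal.ofReal_ofNat]
        gcongr
        exact ENNReal.ofReal_le_ofReal (hPs p p.2)
    _ = (∑' _ : P, 1) * (2 * D) ^ β := by rw [← ENNReal.tsum_mul_right]; simp
    _ ≤ (5 ^ Module.finrank ℝ V * ∑' _ : U, (1 : ℝ≥0∞)) * (2 * D) ^ β := by gcongr
    _ = 2 ^ β * 5 ^ Module.finrank ℝ V * (∑' _ : U, D ^ α) * D ^ (β - α) := by
        have h1 : ∑' _ : U, D ^ α = (∑' _ : U, (1 : ℝ≥0∞)) * D ^ α := by
          rw [← ENNReal.tsum_mul_right]; simp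
        have h2 : D ^ β = D ^ α * D ^ (β - α) := by
          rw [← ENNReal.rpow_add _ _ hD0 hDt]; ring_nf
        rw [h1, ENNReal.mul_rpow_of_nonneg _ _ hβ, h2]
        ring
    _ ≤ _ := by gcongr

lemma uPackPre_le_cPackPre [FiniteDimensional ℝ V] [Nontrivial V] {α β ε ρ : ℝ}
    (hβ : 0 ≤ β) (hρ : 0 < ρ) (hε : ρ ≤ ε) (F : Set V) :
    uPackPre β (2 * ρ) F ≤ 2 ^ β * 5 ^ Module.finrank ℝ V * cPackPre α ε F *
      (1 - ENNReal.ofReal (1 / 2) ^ (β - α))⁻¹ * ENNReal.ofReal ρ ^ (β - α) := by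
  refine iSup_le fun P => iSup_le fun hc => iSup_le fun hP => iSup_le fun hd => ?_
  have hr : ∀ p ∈ P, p.2 ≤ ρ := fun p hp => by
    obtain ⟨-, h2, h3⟩ := hP p hp
    rw [ediam_ball_eq _ h2, ENNReal.ofReal_le_ofReal_iff (by positivity)] at h3
    linarith
  let s : ℕ → ℝ := fun k => ρ * (1 / 2) ^ k / 2
  have hs : ∀ k, 0 < s k := fun k => by positivity
  let Q : ℕ → Set (V × ℝ) := fun k => {p ∈ P | s k < p.2 ∧ p.2 ≤ 2 * s k}
  have hQ : P = ⋃ k, Q k := by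
    refine Subset.antisymm (fun p hp => ?_) (iUnion_subset fun k p hp => hp.1)
    obtain ⟨k, hk1, hk2⟩ := exists_nat_pow_near_of_lt_one (div_pos (hP p hp).2.1 hρ)
      ((div_le_one hρ).2 (hr p hp)) (y := (1 / 2 : ℝ)) (by norm_num) (by norm_num)
    rw [lt_div_iff₀ hρ, pow_succ] at hk1
    rw [div_le_iff₀ hρ] at hk2
    refine mem_iUnion.2 ⟨k, hp, ?_, ?_⟩ <;> simp only [s] <;> linarith
  set C := 2 ^ β * 5 ^ Module.finrank ℝ V * cPackPre α ε F
  calc ∑' p : P, EMetric.diam (ball p.1.1 p.1.2) ^ β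
      = ∑' p : ⋃ k, Q k, EMetric.diam (ball p.1.1 p.1.2) ^ β :=
        tsum_congr_set_coe (fun p : V × ℝ => EMetric.diam (ball p.1 p.2) ^ β) hQ
    _ ≤ ∑' k, ∑' p : Q k, EMetric.diam (ball p.1.1 p.1.2) ^ β :=
        ENNReal.tsum_iUnion_le_tsum (fun p : V × ℝ => EMetric.diam (ball p.1 p.2) ^ β) Q
    _ ≤ ∑' k, C * ENNReal.ofReal (2 * s k) ^ (β - α) := by
        refine ENNReal.tsum_le_tsum fun k => ?_
        have hsub : Q k ⊆ P := fun p hp => hp.1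
        refine tsum_ediam_rpow_le_cPackPre hβ (hs k) (le_trans ?_ hε) (hc.mono hsub)
          (fun p hp => (hP p hp.1).1) (fun p hp => hp.2.1) (fun p hp => hp.2.2) (hd.mono hsub)
        have h1 : (1 / 2 : ℝ) ^ k ≤ 1 := pow_le_one₀ (by norm_num) (by norm_num)
        simp only [s]
        nlinarith
    _ = ∑' k, C * ENNReal.ofReal ρ ^ (β - α) * (ENNReal.ofReal (1 / 2) ^ (β - α)) ^ k := by
        refine tsum_congr fun k => ?_
        have h1 : 2 * s k = ρ * (1 / 2) ^ k := by simp only [s]; ring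
        rw [h1, ENNReal.ofReal_mul hρ.le, ENNReal.ofReal_pow (by norm_num),
          ENNReal.mul_rpow_of_ne_top ENNReal.ofReal_ne_top
            (ENNReal.pow_ne_top ENNReal.ofReal_ne_top), ← mul_assoc,
          ← ENNReal.rpow_natCast_mul, ← ENNReal.rpow_mul_natCast, mul_comm (k : ℝ)]
    _ = _ := by
        rw [ENNReal.tsum_mul_left, ENNReal.tsum_geometric]
        ring

lemma uPackPre0_eq_zero_of_lt [FiniteDimensional ℝ V] {α β : ℝ} (hα : 0 ≤ α) (hαβ : α < β)
    {F : Set V} (hF : cPackPre0 α F ≠ ∞) : uPackPre0 β F = 0 := by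
  have hγ : 0 < β - α := sub_pos.2 hαβ
  rcases subsingleton_or_nontrivial V with _ | _
  · refine le_antisymm (iInf₂_le_of_le 1 one_pos ?_) zero_le
    refine iSup_le fun P => iSup_le fun _ => iSup_le fun _ => iSup_le fun _ => ?_
    simp [EMetric.diam, Metric.ediam_subsingleton (subsingleton_of_subsingleton),
      ENNReal.zero_rpow_of_pos (hα.trans_lt hαβ)]
  · obtain ⟨ε, hε, hfin⟩ : ∃ ε : ℝ, 0 < ε ∧ cPackPre α ε F < ∞ := by
      simpa [cPackPre0, iInf_lt_iff] using hF.lt_top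
    set K := 2 ^ β * 5 ^ Module.finrank ℝ V * cPackPre α ε F *
      (1 - ENNReal.ofReal (1 / 2) ^ (β - α))⁻¹
    have hq : ENNReal.ofReal (1 / 2) ^ (β - α) < 1 :=
      ENNReal.rpow_lt_one (by rw [ENNReal.ofReal_lt_one]; norm_num) hγ
    have hKt : K ≠ ∞ := by
      refine ENNReal.mul_ne_top (ENNReal.mul_ne_top (ENNReal.mul_ne_top ?_ ?_) hfin.ne) ?_
      · exact ENNReal.rpow_ne_top_of_nonneg (hα.trans hαβ.le) (by norm_num)
      · exact ENNReal.pow_ne_top (by norm_num)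
      · exact ENNReal.inv_ne_top.2 (tsub_pos_of_lt hq).ne'
    have hlim : Tendsto (fun ρ : ℝ => K * ENNReal.ofReal ρ ^ (β - α)) (nhdsWithin 0 (Ioi 0)) (nhds 0) := by
      have h1 : Tendsto (fun ρ : ℝ => ENNReal.ofReal ρ ^ (β - α)) (nhdsWithin 0 (Ioi 0)) (nhds 0) := by
        have h2 : Continuous fun ρ : ℝ => ENNReal.ofReal ρ ^ (β - α) :=
          ENNReal.continuous_rpow_const.comp ENNReal.continuous_ofReal
        have h3 := (h2.tendsto 0).mono_left (nhdsWithin_le_nhds (s := Ioi 0))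
        simpa [ENNReal.zero_rpow_of_pos hγ] using h3
      simpa using ENNReal.Tendsto.const_mul h1 (Or.inr hKt)
    refine le_antisymm (ge_of_tendsto hlim ?_) zero_le
    filter_upwards [Ioo_mem_nhdsGT hε] with ρ hρ
    exact (iInf₂_le (2 * ρ) (by linarith [hρ.1])).trans
      (uPackPre_le_cPackPre (hα.trans hαβ.le) hρ.1 hρ.2.le F)

lemma uPackMeasure_eq_zero_of_lt [FiniteDimensional ℝ V] {α β : ℝ} (hα : 0 ≤ α) (hαβ : α < β)
    {E : Set V} (hE : cPackMeasure α E = 0) : uPackMeasure β E = 0 := by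
  obtain ⟨c, hc, hsum⟩ : ∃ c : ℕ → Set V, E ⊆ ⋃ n, c n ∧ ∑' n, cPackPre0 α (c n) < 1 := by
    have h : cPackMeasure α E < 1 := by simp [hE]
    simpa only [cPackMeasure, iInf_lt_iff, exists_prop] using h
  refine le_antisymm (iInf₂_le_of_le c hc ?_) zero_le
  have h0 : ∀ n, uPackPre0 β (c n) = 0 := fun n =>
    uPackPre0_eq_zero_of_lt hα hαβ
      (ENNReal.ne_top_of_tsum_ne_top (hsum.trans ENNReal.one_lt_top).ne n)
  simp [h0]

end NormedSpace

/-- In `ℝ^n`, the uncentered packing dimension of any set equals its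
packing dimension. -/
theorem statement1 (n : ℕ) (E : Set (EuclideanSpace ℝ (Fin n))) :
    uPackDim E = cPackDim E := by
  refine le_antisymm ?_ (cPackDim_le_uPackDim E)
  refine le_iInf fun α => le_iInf fun hα => le_iInf fun h => ?_
  refine ENNReal.le_of_forall_pos_le_add fun δ hδ _ => ?_
  have hδ' : (0 : ℝ) < δ := hδ
  calc uPackDim E ≤ ENNReal.ofReal (α + δ) :=
        iInf_le_of_le _ <| iInf_le_of_le (by positivity) <|
          iInf_le_of_le (uPackMeasure_eq_zero_of_lt hα (by linarith) h) le_rfl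
    _ = ENNReal.ofReal α + δ := by
        rw [ENNReal.ofReal_add hα hδ'.le, ENNReal.ofReal_coe_nnreal]

end
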